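/- For every bounded set S ⊂ M_d(ℂ): max_{1 ≤ k ≤ 2d³} Λ(S^k)^{1/k} ≥ ρ(S)/(2⁸d⁵). Consequently max_{1 ≤ k ≤ N₂(d)} Λ(S^k)^{1/k} ≥ ρ(S)/2, where N₂(d) = 2d³⌈8 + 5 log₂ d⌉. -/

import Mathlib

open scoped Pointwise
open Filter

/-- A norm on `ℂ^d`, given as a plain function with the norm axioms. -/
def IsCNorm {d : ℕ} (v : (Fin d → ℂ) → ℝ) : Prop :=
  (∀ x, 0 ≤ v x) ∧ (∀ x, v x = 0 ↔ x = 0) ∧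
  (∀ (a : ℂ) (x), v (a • x) = ‖a‖ * v x) ∧ (∀ x y, v (x + y) ≤ v x + v y)

/-- Operator norm on matrices induced by the norm `v` on `ℂ^d`. -/
noncomputable def opNorm {d : ℕ} (v : (Fin d → ℂ) → ℝ) (A : Matrix (Fin d) (Fin d) ℂ) : ℝ :=
  sSup {c : ℝ | ∃ x : Fin d → ℂ, v x ≤ 1 ∧ c = v (A.mulVec x)}

/-- Norm of a set of matrices: `sup_{s ∈ S} ‖s‖`. -/
noncomputable def setOpNorm {d : ℕ} (v : (Fin d → ℂ) → ℝ)
    (S : Set (Matrix (Fin d) (Fin d) ℂ)) : ℝ :=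
  sSup (opNorm v '' S)

/-- The sup norm on `ℂ^d`, used as reference norm to define the joint spectral radius. -/
noncomputable def stdNorm {d : ℕ} (x : Fin d → ℂ) : ℝ := ‖x‖

/-- The joint spectral radius `ρ(S) = inf_{n ≥ 1} ‖Sⁿ‖^{1/n}`. -/
noncomputable def jsr {d : ℕ} (S : Set (Matrix (Fin d) (Fin d) ℂ)) : ℝ :=
  ⨅ n : ℕ, setOpNorm stdNorm (S ^ (n + 1)) ^ (1 / (n + 1 : ℝ))

/-- The spectral radius of a matrix: the largest modulus of an eigenvalue. -/
noncomputable def specRad {d : ℕ} (A : Matrix (Fin d) (Fin d) ℂ) : ℝ :=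
  sSup ((fun μ : ℂ => ‖μ‖) '' spectrum ℂ A)

/-- `Λ(S) = sup_{s ∈ S} Λ(s)`. -/
noncomputable def lamSet {d : ℕ} (S : Set (Matrix (Fin d) (Fin d) ℂ)) : ℝ :=
  sSup (specRad '' S)

/-- Boundedness of a set of matrices. -/
def MatBdd {d : ℕ} (S : Set (Matrix (Fin d) (Fin d) ℂ)) : Prop :=
  ∃ C : ℝ, ∀ A ∈ S, ∀ i j, ‖A i j‖ ≤ C

/-- `S` is irreducible: it preserves no nonzero proper subspace of `ℂ^d`. -/
def IsIrred {d : ℕ} (S : Set (Matrix (Fin d) (Fin d) ℂ)) : Prop :=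
  ∀ W : Submodule ℂ (Fin d → ℂ), (∀ A ∈ S, ∀ x ∈ W, A.mulVec x ∈ W) → W = ⊥ ∨ W = ⊤


open Polynomial in
theorem det_aeval_eq {d : ℕ} (M : Matrix (Fin d) (Fin d) ℂ) (q : ℂ[X]) :
    (aeval M q).det = (M.charpoly.roots.map (fun ν => q.eval ν)).prod := by
  have hcard : Multiset.card M.charpoly.roots = d := by
    rw [Polynomial.splits_iff_card_roots.1 (IsAlgClosed.splits _),
      Matrix.charpoly_natDegree_eq_dim, Fintype.card_fin]
  have hlin : ∀ α : ℂ, (aeval M (X - C α)).det = (M.charpoly.roots.map (fun ν => ν - α)).prod := by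
    intro α
    have h1 := Matrix.eval_charpoly M α
    rw [(IsAlgClosed.splits M.charpoly).eq_prod_roots_of_monic M.charpoly_monic,
      Polynomial.eval_multiset_prod, Multiset.map_map] at h1
    have h2 : aeval M (X - C α) = -(Matrix.scalar (Fin d) α - M) := by
      simp [Matrix.algebraMap_eq_diagonal, Pi.algebraMap_def]
    rw [h2, Matrix.det_neg, ← h1, Fintype.card_fin]
    have : (fun ν : ℂ => ν - α) = fun ν => (-1) * (α - ν) := by ext; ring
    rw [this, Multiset.prod_map_mul]
    simp [hcard]
  have hq := (IsAlgClosed.splits q).eq_prod_roots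
  have hd : ∀ s : Multiset ℂ, (aeval M (s.map (fun α => X - C α)).prod).det =
      (M.charpoly.roots.map (fun ν => ((s.map (fun α => X - C α)).prod).eval ν)).prod := by
    intro s
    induction s using Multiset.induction_on with
    | empty => simp
    | cons a s ih =>
      simp only [Multiset.map_cons, Multiset.prod_cons, map_mul, Matrix.det_mul, ih, hlin,
        eval_mul, Multiset.prod_map_mul]
      simp
  rw [hq, map_mul, Matrix.det_mul, hd]
  simp only [eval_mul, Multiset.prod_map_mul]
  congr 1
  simp [Matrix.algebraMap_eq_diagonal, hcard, Matrix.det_diagonal]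

open Polynomial in
theorem exists_eig {d : ℕ} (M : Matrix (Fin d) (Fin d) ℂ) :
    ∃ ν : Fin d → ℂ, M.charpoly.roots = Multiset.map ν Finset.univ.val ∧
      ∀ k : ℕ, (M ^ k).trace = ∑ i, ν i ^ k := by
  have hcard : Multiset.card M.charpoly.roots = d := by
    rw [Polynomial.splits_iff_card_roots.1 (IsAlgClosed.splits _),
      Matrix.charpoly_natDegree_eq_dim, Fintype.card_fin]
  have hex : ∃ ν : Fin d → ℂ, M.charpoly.roots = Multiset.map ν Finset.univ.val := by
    have hl : M.charpoly.roots.toList.length = d := by simpa using hcard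
    refine ⟨fun i => M.charpoly.roots.toList.get (i.cast hl.symm), ?_⟩
    rw [Fin.univ_val_map]
    conv_lhs => rw [← Multiset.coe_toList M.charpoly.roots]
    congr 1
    apply List.ext_get
    · simp [hcard]
    · intro n h1 h2; simp
  obtain ⟨ν, hν⟩ := hex
  refine ⟨ν, hν, fun k => ?_⟩
  have hpoly : (M ^ k).charpoly = (M.charpoly.roots.map (fun ν => X - C (ν ^ k))).prod := by
    apply Polynomial.funext
    intro z
    rw [Matrix.eval_charpoly, Polynomial.eval_multiset_prod, Multiset.map_map]
    have := det_aeval_eq M (C z - X ^ k)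
    simp only [map_sub, map_pow, aeval_X, aeval_C, eval_sub, eval_C, eval_pow, eval_X] at this
    rw [Function.comp_def]
    simp only [eval_sub, eval_X, eval_C]
    rw [← this]
    simp [Matrix.algebraMap_eq_diagonal, Pi.algebraMap_def]
  rw [Matrix.trace_eq_sum_roots_charpoly, hpoly]
  have : (M.charpoly.roots.map (fun ν => X - C (ν ^ k))) =
    ((M.charpoly.roots.map (fun ν => ν ^ k)).map (fun a => X - C a)) := by
    rw [Multiset.map_map]; rfl
  rw [this, Polynomial.roots_multiset_prod_X_sub_C, hν, Multiset.map_map]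
  rfl

theorem esymm_bound {d : ℕ} (ν : Fin d → ℂ) (β : ℝ) (hβ : 0 ≤ β)
    (h : ∀ k, 1 ≤ k → k ≤ d → ‖∑ i, ν i ^ k‖ ≤ d * β ^ k) :
    ∀ k, k ≤ d → ‖(Multiset.map ν Finset.univ.val).esymm k‖ ≤ (d * β) ^ k := by
  intro k
  induction k using Nat.strong_induction_on with
  | _ k ih =>
  intro hk
  rcases Nat.eq_zero_or_pos k with rfl | hk0
  · simp [Multiset.esymm, -Fin.univ_val_map]
  have hd1 : (1:ℝ) ≤ d := by exact_mod_cast le_trans hk0 hk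
  have hN := congrArg (MvPolynomial.aeval ν) (MvPolynomial.mul_esymm_eq_sum (Fin d) ℂ k)
  simp only [map_mul, map_natCast, map_sum, map_pow, map_neg, map_one,
    MvPolynomial.aeval_esymm_eq_multiset_esymm] at hN
  have hp : ∀ j, MvPolynomial.aeval ν (MvPolynomial.psum (Fin d) ℂ j) = ∑ i, ν i ^ j := by
    intro j; simp [MvPolynomial.psum]
  simp only [hp] at hN
  have hn := congrArg norm hN
  simp only [norm_mul, norm_pow, norm_neg, norm_one, one_pow, one_mul, Complex.norm_natCast] at hn
  have hle : ‖∑ a ∈ (Finset.HasAntidiagonal.antidiagonal k) with a.1 < k,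
      (-1) ^ a.1 * (Multiset.map ν Finset.univ.val).esymm a.1 * ∑ i, ν i ^ a.2‖
      ≤ k * (d * β) ^ k := by
    refine (norm_sum_le _ _).trans ?_
    have hcard : ((Finset.HasAntidiagonal.antidiagonal k).filter (fun a => a.1 < k)).card ≤ k := by
      have : ((Finset.HasAntidiagonal.antidiagonal k).filter (fun a => a.1 < k)).card ≤ (Finset.range k).card := by
        apply Finset.card_le_card_of_injOn (fun a => a.1)
        · intro a ha
          simp at ha ⊢
          exact ha.2
        · intro a ha b hb hab
          simp at ha hb hab
          ext
          · exact hab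
          · omega
      simpa using this
    refine (Finset.sum_le_card_nsmul _ _ ((d * β) ^ k) ?_).trans ?_
    · rintro ⟨a, b⟩ hab
      simp at hab
      obtain ⟨hab, hak⟩ := hab
      have e1 := ih a hak (by omega)
      have e2 := h b (by omega) (by omega)
      simp only [norm_mul, norm_pow, norm_neg, norm_one, one_pow, one_mul]
      have e3 : (d:ℝ) * β ^ b ≤ (d * β) ^ b := by
        rw [mul_pow]
        gcongr
        exact le_self_pow₀ hd1 (by omega)
      calc _ ≤ (d * β) ^ a * (d * β) ^ b := by
            gcongr
            exact e2.trans e3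
        _ = _ := by rw [← pow_add, hab]
    · rw [nsmul_eq_mul]
      gcongr
  rw [← hn] at hle
  have : (0:ℝ) < k := by exact_mod_cast hk0
  exact le_of_mul_le_mul_left hle this

theorem charpoly_coeff_bound {d : ℕ} (M : Matrix (Fin d) (Fin d) ℂ) (β : ℝ) (hβ : 0 ≤ β)
    (h : ∀ k, 1 ≤ k → k ≤ d → ‖(M ^ k).trace‖ ≤ d * β ^ k) :
    ∀ k, k ≤ d → ‖M.charpoly.coeff k‖ ≤ (d * β) ^ (d - k) := by
  obtain ⟨ν, h1, h2⟩ := exists_eig M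
  intro k hk
  have hdeg : M.charpoly.natDegree = d := by
    rw [Matrix.charpoly_natDegree_eq_dim, Fintype.card_fin]
  rw [Polynomial.coeff_eq_esymm_roots_of_splits (IsAlgClosed.splits _) (by rw [hdeg]; exact hk),
    M.charpoly_monic.leadingCoeff, hdeg, h1]
  simp only [norm_mul, norm_pow, norm_neg, norm_one, one_pow, one_mul]
  apply esymm_bound ν β hβ _ _ (by omega)
  intro j hj hjd
  rw [← h2]
  exact h j hj hjd

theorem perturb {d : ℕ} (hd : 0 < d) (M : Matrix (Fin d) (Fin d) ℂ) (v : Seminorm ℂ (Fin d → ℂ))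
    (x : Fin d → ℂ) (B β δ : ℝ) (hβ : 0 ≤ β) (hB : 1 ≤ B) (hβd : d * β ≤ 1 / 4)
    (hMv : ∀ y, v (M.mulVec y) ≤ B * v y)
    (hx : v (x - M.mulVec x) ≤ δ)
    (h : ∀ k, 1 ≤ k → k ≤ d → ‖(M ^ k).trace‖ ≤ d * β ^ k) :
    v x ≤ 4 * d * B ^ (d - 1) * δ := by
  have hδ : 0 ≤ δ := (apply_nonneg v _).trans hx
  have hc := charpoly_coeff_bound M β hβ h
  have hdeg : M.charpoly.natDegree = d := by
    rw [Matrix.charpoly_natDegree_eq_dim, Fintype.card_fin]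
  have hpow : ∀ k : ℕ, v (x - (M ^ k).mulVec x) ≤ k * B ^ (k - 1) * δ := by
    intro k
    induction k with
    | zero => simp
    | succ k ih =>
      have e : x - (M ^ (k + 1)).mulVec x = (x - M.mulVec x) + M.mulVec (x - (M ^ k).mulVec x) := by
        rw [Matrix.mulVec_sub, Matrix.mulVec_mulVec, ← pow_succ']; abel
      rw [e]
      refine (map_add_le_add v _ _).trans ?_
      have h1 := hMv (x - (M ^ k).mulVec x)
      have h2 : B * v (x - (M ^ k).mulVec x) ≤ k * B ^ k * δ := by
        rcases k with _ | k
        · simp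
        · calc _ ≤ B * ((k + 1 : ℕ) * B ^ (k + 1 - 1) * δ) := by gcongr
            _ = _ := by simp [pow_succ]; ring
      have h3 : δ ≤ B ^ k * δ := le_mul_of_one_le_left hδ (one_le_pow₀ hB)
      rw [Nat.add_sub_cancel]
      push_cast
      linarith
  have hpow' : ∀ k, k ≤ d → v (x - (M ^ k).mulVec x) ≤ d * B ^ (d - 1) * δ := by
    intro k hk
    refine (hpow k).trans ?_
    gcongr
  have hCH := Matrix.aeval_self_charpoly M
  rw [Polynomial.aeval_eq_sum_range, hdeg] at hCH
  have hCHx : ∑ k ∈ Finset.range (d + 1), M.charpoly.coeff k • (M ^ k).mulVec x = 0 := by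
    have := congrArg (fun N : Matrix (Fin d) (Fin d) ℂ => N.mulVec x) hCH
    simpa [Matrix.sum_mulVec, Matrix.smul_mulVec] using this
  have hsum : (∑ k ∈ Finset.range (d + 1), M.charpoly.coeff k) • x =
      ∑ k ∈ Finset.range (d + 1), M.charpoly.coeff k • (x - (M ^ k).mulVec x) := by
    simp only [smul_sub, Finset.sum_sub_distrib, hCHx, sub_zero, Finset.sum_smul]
  have hgeo : ∀ m : ℕ, ∑ k ∈ Finset.range m, (1 / 4 : ℝ) ^ (m - k) ≤ 1 / 2 := by
    intro m
    induction m with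
    | zero => simp
    | succ m ih =>
      rw [Finset.sum_range_succ]
      have : ∑ k ∈ Finset.range m, (1 / 4 : ℝ) ^ (m + 1 - k) =
          (1 / 4) * ∑ k ∈ Finset.range m, (1 / 4 : ℝ) ^ (m - k) := by
        rw [Finset.mul_sum]
        apply Finset.sum_congr rfl
        intro k hk
        rw [Finset.mem_range] at hk
        rw [Nat.succ_sub hk.le, pow_succ]; ring
      rw [this, Nat.add_sub_cancel_left, pow_one]
      linarith
  have hcs : ∑ k ∈ Finset.range d, ‖M.charpoly.coeff k‖ ≤ 1 / 2 := by
    refine le_trans (Finset.sum_le_sum fun k hk => ?_) (hgeo d)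
    rw [Finset.mem_range] at hk
    refine (hc k hk.le).trans ?_
    gcongr
  have hcd : M.charpoly.coeff d = 1 := by
    have := M.charpoly_monic.coeff_natDegree
    rwa [hdeg] at this
  have hlow : 1 / 2 ≤ ‖∑ k ∈ Finset.range (d + 1), M.charpoly.coeff k‖ := by
    rw [Finset.sum_range_succ, hcd]
    have h1 := norm_sum_le (Finset.range d) (fun k => M.charpoly.coeff k)
    have h2 := norm_sub_le (∑ k ∈ Finset.range d, M.charpoly.coeff k + 1)
      (∑ k ∈ Finset.range d, M.charpoly.coeff k)
    rw [add_sub_cancel_left, norm_one] at h2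
    linarith
  have hv := congrArg v hsum
  rw [map_smul_eq_mul] at hv
  have hup : v (∑ k ∈ Finset.range (d + 1), M.charpoly.coeff k • (x - (M ^ k).mulVec x)) ≤
      2 * (d * B ^ (d - 1) * δ) := by
    have h1 : v (∑ k ∈ Finset.range (d + 1), M.charpoly.coeff k • (x - (M ^ k).mulVec x)) ≤
      ∑ k ∈ Finset.range (d + 1), v (M.charpoly.coeff k • (x - (M ^ k).mulVec x)) :=
      Finset.le_sum_of_subadditive v (map_zero v).le (map_add_le_add v) _ _
    refine h1.trans ?_
    calc _ ≤ ∑ k ∈ Finset.range (d + 1), ‖M.charpoly.coeff k‖ * (d * B ^ (d - 1) * δ) := by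
          apply Finset.sum_le_sum
          intro k hk
          rw [Finset.mem_range] at hk
          rw [map_smul_eq_mul]
          gcongr
          exact hpow' k (by omega)
      _ ≤ _ := by
          rw [← Finset.sum_mul, Finset.sum_range_succ, hcd, norm_one]
          gcongr
          linarith
  rw [← hv] at hup
  have : 1 / 2 * v x ≤ ‖∑ k ∈ Finset.range (d + 1), M.charpoly.coeff k‖ * v x := by
    gcongr
  linarith

theorem path_exists {d : ℕ} (T : Set (Matrix (Fin d) (Fin d) ℂ)) (n : ℕ) :
    ∀ w ∈ T ^ n, ∀ x0 : Fin d → ℂ, ∃ x : ℕ → (Fin d → ℂ), x 0 = x0 ∧ x n = w.mulVec x0 ∧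
      ∀ i < n, ∃ s ∈ T, x (i + 1) = s.mulVec (x i) := by
  induction n with
  | zero =>
    intro w hw x0
    rw [pow_zero, Set.mem_one] at hw
    exact ⟨fun _ => x0, rfl, by simp [hw], by simp⟩
  | succ n ih =>
    intro w hw x0
    rw [pow_succ', Set.mem_mul] at hw
    obtain ⟨s, hs, w', hw', rfl⟩ := hw
    obtain ⟨x, h0, hn, hx⟩ := ih w' hw' x0
    refine ⟨fun i => if i ≤ n then x i else s.mulVec (x n), by simp [h0], ?_, ?_⟩
    · simp [hn, Matrix.mulVec_mulVec]
    · intro i hi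
      rcases Nat.lt_or_ge i n with h | h
      · obtain ⟨s', hs', e⟩ := hx i h
        refine ⟨s', hs', ?_⟩
        simp [h.le, Nat.succ_le_of_lt h, e]
      · have : i = n := by omega
        subst this
        exact ⟨s, hs, by simp⟩

theorem path_word {d : ℕ} (T : Set (Matrix (Fin d) (Fin d) ℂ)) (n : ℕ) (x : ℕ → (Fin d → ℂ))
    (hx : ∀ i < n, ∃ s ∈ T, x (i + 1) = s.mulVec (x i)) (i j : ℕ) (hij : i + j ≤ n) :
    ∃ w ∈ T ^ j, x (i + j) = w.mulVec (x i) := by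
  induction j with
  | zero => exact ⟨1, by simp, by simp⟩
  | succ j ih =>
    obtain ⟨w, hw, e⟩ := ih (by omega)
    obtain ⟨s, hs, e'⟩ := hx (i + j) (by omega)
    refine ⟨s * w, ?_, ?_⟩
    · rw [pow_succ']; exact Set.mul_mem_mul hs hw
    · rw [← Matrix.mulVec_mulVec, ← e, ← e']; rfl

theorem word_contr {d : ℕ} (T : Set (Matrix (Fin d) (Fin d) ℂ)) (v : Seminorm ℂ (Fin d → ℂ))
    (hT : ∀ A ∈ T, ∀ x, v (A.mulVec x) ≤ v x) (n : ℕ) :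
    ∀ w ∈ T ^ n, ∀ x, v (w.mulVec x) ≤ v x := by
  induction n with
  | zero =>
    intro w hw x
    rw [pow_zero, Set.mem_one] at hw
    simp [hw]
  | succ n ih =>
    intro w hw x
    rw [pow_succ', Set.mem_mul] at hw
    obtain ⟨s, hs, w', hw', rfl⟩ := hw
    rw [← Matrix.mulVec_mulVec]
    exact (hT s hs _).trans (ih w' hw' x)

theorem vol_lemma {d : ℕ} (z : ℕ → (Fin d → ℂ)) (n : ℕ) (A L U : ℝ) (hA : 0 < A) (hL : 0 < L)
    (hlow : L ≤ ‖(Matrix.of fun r c : Fin d => z (n + 1 + c) r).det‖)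
    (hup : ∀ g : Fin d → ℕ, ‖(Matrix.of fun r c : Fin d => z (g c) r).det‖ ≤ U)
    (hU : U < A ^ (n + 1) * L) :
    ∃ i ≤ n, ∃ g : Fin d → ℕ, ∃ a : Fin d → ℂ, (∀ l, i < g l ∧ g l ≤ n + d) ∧
      (∀ l, ‖a l‖ ≤ A) ∧ z i = ∑ l, a l • z (g l) := by
  set D : (Fin d → ℕ) → ℝ := fun g => ‖(Matrix.of fun r c : Fin d => z (g c) r).det‖ with hD
  have hmax : ∀ i, i ≤ n + 1 → ∃ g : Fin d → ℕ, (∀ l, i ≤ g l ∧ g l ≤ n + d) ∧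
      ∀ g' : Fin d → ℕ, (∀ l, i ≤ g' l ∧ g' l ≤ n + d) → D g' ≤ D g := by
    intro i hi
    have hne : (Fintype.piFinset (fun _ : Fin d => Finset.Icc i (n + d))).Nonempty := by
      refine ⟨fun c => n + 1 + c, ?_⟩
      rw [Fintype.mem_piFinset]
      intro c
      rw [Finset.mem_Icc]
      have := c.2
      omega
    obtain ⟨g, hg, hg'⟩ := Finset.exists_max_image _ D hne
    refine ⟨g, ?_, ?_⟩
    · intro l
      exact Finset.mem_Icc.1 (Fintype.mem_piFinset.1 hg l)
    · intro g' h
      exact hg' g' (Fintype.mem_piFinset.2 fun l => Finset.mem_Icc.2 (h l))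
  choose! G hG1 hG2 using hmax
  have hlast : L ≤ D (G (n + 1)) := by
    refine hlow.trans (hG2 (n + 1) le_rfl (fun c => n + 1 + c) ?_)
    intro c
    have := c.2
    omega
  have hpos : ∀ i ≤ n + 1, L ≤ D (G i) := by
    intro i hi
    refine hlast.trans (hG2 i hi _ ?_)
    intro l
    have := hG1 (n + 1) le_rfl l
    omega
  have hex : ∃ i ≤ n, D (G i) ≤ A * D (G (i + 1)) := by
    by_contra hcon
    push Not at hcon
    have : ∀ k, k ≤ n + 1 → A ^ k * L ≤ D (G (n + 1 - k)) := by
      intro k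
      induction k with
      | zero => intro _; simpa using hlast
      | succ k ih =>
        intro hk
        have h1 := ih (by omega)
        have h2 := hcon (n + 1 - (k + 1)) (by omega)
        have e : n + 1 - (k + 1) + 1 = n + 1 - k := by omega
        rw [e] at h2
        rw [pow_succ']
        calc A * A ^ k * L = A * (A ^ k * L) := by ring
          _ ≤ A * D (G (n + 1 - k)) := by gcongr
          _ ≤ _ := h2.le
    have h3 := this (n + 1) le_rfl
    have h4 := hup (G (n + 1 - (n + 1)))
    linarith
  obtain ⟨i, hi, hle⟩ := hex
  set g := G (i + 1) with hg
  have hgpos : 0 < D g := lt_of_lt_of_le hL (hpos (i + 1) (by omega))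
  set Mg : Matrix (Fin d) (Fin d) ℂ := Matrix.of fun r c : Fin d => z (g c) r with hMg
  have hdet : Mg.det ≠ 0 := by
    intro h0
    simp only [hD] at hgpos
    rw [← hMg, h0, norm_zero] at hgpos
    exact lt_irrefl _ hgpos
  refine ⟨i, hi, g, fun l => Mg.det⁻¹ * Matrix.cramer Mg (z i) l, ?_, ?_, ?_⟩
  · intro l
    have := hG1 (i + 1) (by omega) l
    exact ⟨this.1, this.2⟩
  · intro l
    show ‖Mg.det⁻¹ * Matrix.cramer Mg (z i) l‖ ≤ A
    rw [Matrix.cramer_apply]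
    have e : Mg.updateCol l (z i) = Matrix.of fun r c : Fin d => z (Function.update g l i c) r := by
      ext r c
      rw [Matrix.updateCol_apply]
      by_cases h : c = l
      · subst h; simp
      · simp [h, hMg]
    have h1 : ‖(Mg.updateCol l (z i)).det‖ ≤ D (G i) := by
      rw [e]
      refine hG2 i (by omega) (Function.update g l i) ?_
      intro c
      by_cases h : c = l
      · subst h; simp; omega
      · have := hG1 (i + 1) (by omega) c
        simp [h]
        rw [← hg] at this
        omega
    rw [norm_mul, norm_inv, inv_mul_le_iff₀ (norm_pos_iff.2 hdet)]
    calc _ ≤ D (G i) := h1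
      _ ≤ A * D g := hle
      _ = _ := by rw [mul_comm]
  · have h := Matrix.mulVec_cramer Mg (z i)
    have h2 : z i = Mg.det⁻¹ • (Mg.mulVec (Matrix.cramer Mg (z i))) := by
      rw [h, smul_smul, inv_mul_cancel₀ hdet, one_smul]
    conv_lhs => rw [h2]
    ext r
    simp only [Pi.smul_apply, Matrix.mulVec, dotProduct, Finset.sum_apply, smul_eq_mul,
      Finset.mul_sum]
    apply Finset.sum_congr rfl
    intro c _
    simp [hMg]
    ring

theorem exists_basis {d : ℕ} (v : Seminorm ℂ (Fin d → ℂ)) (hv : ∀ x, ‖x‖ ≤ v x) :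
    ∃ e : Fin d → (Fin d → ℂ), (∀ l, v (e l) ≤ 1) ∧
      0 < ‖(Matrix.of fun r c : Fin d => e c r).det‖ ∧
      ∀ y : Fin d → (Fin d → ℂ), (∀ l, v (y l) ≤ 1) →
        ‖(Matrix.of fun r c : Fin d => y c r).det‖ ≤
          2 * ‖(Matrix.of fun r c : Fin d => e c r).det‖ := by
  set X : Set ℝ := (fun y : Fin d → (Fin d → ℂ) => ‖(Matrix.of fun r c : Fin d => y c r).det‖) ''
    {y | ∀ l, v (y l) ≤ 1} with hX
  have hbdd : BddAbove X := by
    refine ⟨(Nat.factorial d : ℝ), ?_⟩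
    rintro _ ⟨y, hy, rfl⟩
    have := Matrix.det_le (A := Matrix.of fun r c : Fin d => y c r)
      (abv := NormedField.toAbsoluteValue ℂ) (x := 1) (by
        intro i j
        have h1 := (norm_le_pi_norm (y j) i).trans ((hv _).trans (hy j))
        exact h1)
    have h2 : ‖(Matrix.of fun r c : Fin d => y c r).det‖ ≤ _ := this
    simpa using h2
  have hpos : ∃ r ∈ X, 0 < r := by
    have hs : ∀ c : Fin d, 0 < v (Pi.single c 1) := by
      intro c
      refine lt_of_lt_of_le ?_ (hv _)
      rw [norm_pos_iff]
      simp
    refine ⟨_, ⟨fun c => ((v (Pi.single c 1) : ℂ)⁻¹) • Pi.single c 1, ?_, rfl⟩, ?_⟩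
    · intro l
      rw [map_smul_eq_mul, norm_inv, Complex.norm_real, Real.norm_of_nonneg (hs l).le,
        inv_mul_cancel₀ (hs l).ne']
    · rw [norm_pos_iff]
      have : (Matrix.of fun r c : Fin d => (((v (Pi.single c 1) : ℂ)⁻¹) •
          (Pi.single c 1 : Fin d → ℂ)) r) =
          Matrix.diagonal (fun c : Fin d => (v (Pi.single c 1) : ℂ)⁻¹) := by
        ext r c
        by_cases h : r = c
        · subst h; simp
        · simp [h]
      show (Matrix.of fun r c : Fin d => (((v (Pi.single c 1) : ℂ)⁻¹) •
          (Pi.single c 1 : Fin d → ℂ)) r).det ≠ 0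
      rw [this, Matrix.det_diagonal, Finset.prod_ne_zero_iff]
      intro c _
      exact inv_ne_zero (by exact_mod_cast (hs c).ne')
  obtain ⟨r, hr, hr0⟩ := hpos
  have hsup : 0 < sSup X := lt_of_lt_of_le hr0 (le_csSup hbdd hr)
  obtain ⟨_, ⟨e, he, rfl⟩, hlt⟩ := exists_lt_of_lt_csSup ⟨r, hr⟩ (half_lt_self hsup)
  refine ⟨e, he, by linarith [half_pos hsup], fun y hy => ?_⟩
  have := le_csSup hbdd ⟨y, hy, rfl⟩
  simp only at this hlt
  linarith

theorem trace_comb {d : ℕ} (T : Set (Matrix (Fin d) (Fin d) ℂ)) (lam : ℝ)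
    (K n : ℕ) (htr : ∀ l ≤ K, ∀ N ∈ T ^ l, ‖N.trace‖ ≤ d * lam ^ l)
    (a : Fin d → ℂ) (W : Fin d → Matrix (Fin d) (Fin d) ℂ) (len : Fin d → ℕ)
    (hlen : ∀ l, len l ≤ n) (hW : ∀ l, a l ≠ 0 → W l ∈ T ^ (len l)) (k : ℕ) :
    ∀ m, m + k * n ≤ K → ∀ N ∈ T ^ m, ‖(N * (∑ l, a l • W l) ^ k).trace‖ ≤
      d * lam ^ m * (∑ l, ‖a l‖ * lam ^ (len l)) ^ k := by
  induction k with
  | zero =>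
    intro m hm N hN
    simpa using htr m (by omega) N hN
  | succ k ih =>
    intro m hm N hN
    rw [pow_succ', ← mul_assoc, Finset.mul_sum, Finset.sum_mul, Matrix.trace_sum]
    refine (norm_sum_le _ _).trans ?_
    rw [pow_succ', ← mul_assoc, Finset.mul_sum, Finset.sum_mul]
    apply Finset.sum_le_sum
    intro l _
    by_cases h0 : a l = 0
    · simp [h0]
    have h1 := ih (m + len l) (by have := hlen l; nlinarith) (N * W l) (by
      rw [pow_add]; exact Set.mul_mem_mul hN (hW l h0))
    rw [mul_smul_comm, smul_mul_assoc, Matrix.trace_smul, norm_smul]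
    calc _ ≤ ‖a l‖ * (d * lam ^ (m + len l) * (∑ l, ‖a l‖ * lam ^ (len l)) ^ k) := by gcongr
      _ = _ := by rw [pow_add]; ring

theorem core {d : ℕ} (hd : 0 < d) (T : Set (Matrix (Fin d) (Fin d) ℂ)) (lam : ℝ)
    (hlam : 0 ≤ lam) (hlam2 : lam * (2 ^ 8 * d ^ 5) ≤ 1)
    (v : Seminorm ℂ (Fin d → ℂ)) (hv : ∀ x, ‖x‖ ≤ v x)
    (hT : ∀ A ∈ T, ∀ x, v (A.mulVec x) ≤ v x)
    (htr : ∀ l ≤ 2 * d ^ 3, ∀ N ∈ T ^ l, ‖N.trace‖ ≤ d * lam ^ l)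
    (w : Matrix (Fin d) (Fin d) ℂ) (hw : w ∈ T ^ (2 * d ^ 2)) (x0 : Fin d → ℂ)
    (hx0 : v x0 ≤ 1) (hwx : 1 / 2 ≤ v (w.mulVec x0)) : False := by
  have hd1 : (1:ℝ) ≤ d := by exact_mod_cast hd
  set n := 2 * d ^ 2 with hn
  have hn1 : 1 ≤ n := by rw [hn]; nlinarith
  obtain ⟨x, hx00, hxn, hx⟩ := path_exists T n w hw x0
  have hup : ∀ i ≤ n, v (x i) ≤ 1 := by
    intro i hi
    obtain ⟨u, hu, e⟩ := path_word T n x hx 0 i (by omega)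
    rw [zero_add] at e
    rw [e, hx00]
    exact (word_contr T v hT i u hu x0).trans hx0
  have hlo : ∀ i ≤ n, 1 / 2 ≤ v (x i) := by
    intro i hi
    obtain ⟨u, hu, e⟩ := path_word T n x hx i (n - i) (by omega)
    have e2 : i + (n - i) = n := by omega
    rw [e2, hxn] at e
    rw [e] at hwx
    exact hwx.trans (word_contr T v hT _ u hu _)
  obtain ⟨e, he1, hepos, hemax⟩ := exists_basis v hv
  set De := ‖(Matrix.of fun r c : Fin d => e c r).det‖ with hDe
  set A : ℝ := 64 * d ^ 3 with hA
  have hd3 : (1:ℝ) ≤ d ^ 3 := one_le_pow₀ hd1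
  have hA1 : 64 ≤ A := by rw [hA]; linarith
  have hA0 : 0 < A := by linarith
  have hdA : 1 ≤ d * A := by nlinarith
  set ε : ℝ := 1 / (16 * d * (d * A) ^ d) with hε
  have hdApow : 1 ≤ (d * A) ^ d := one_le_pow₀ hdA
  have hden : 1 ≤ 16 * d * (d * A) ^ d := by nlinarith
  have hε0 : 0 < ε := by rw [hε]; positivity
  have hε1 : ε ≤ 1 := by rw [hε, div_le_one (by linarith)]; exact hden
  set z : ℕ → (Fin d → ℂ) := fun j => if j ≤ n then x j else
    if h : j - (n + 1) < d then (ε : ℂ) • e ⟨j - (n + 1), h⟩ else 0 with hz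
  have hzbig : ∀ j, n < j → v (z j) ≤ ε := by
    intro j hj
    simp only [hz, if_neg (not_le.2 hj)]
    split_ifs with h
    · rw [map_smul_eq_mul, Complex.norm_real, Real.norm_of_nonneg hε0.le]
      exact mul_le_of_le_one_right hε0.le (he1 _)
    · simpa using hε0.le
  have hzle : ∀ j, v (z j) ≤ 1 := by
    intro j
    rcases Nat.lt_or_ge n j with h | h
    · exact (hzbig j h).trans hε1
    · simp only [hz, if_pos h]
      exact hup j h
  obtain ⟨i, hi, g, a, hg, ha, hzi⟩ := vol_lemma z n A (ε ^ d * De) (2 * De) hA0 (by positivity)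
    (by
      have : (Matrix.of fun r c : Fin d => z (n + 1 + c) r) =
          (ε : ℂ) • (Matrix.of fun r c : Fin d => e c r) := by
        ext r c
        have h1 : ¬ (n + 1 + (c:ℕ) ≤ n) := by omega
        simp [hz, h1]
      rw [this, Matrix.det_smul, norm_mul, norm_pow, Complex.norm_real,
        Real.norm_of_nonneg hε0.le, Fintype.card_fin])
    (fun g' => hemax (fun l => z (g' l)) (fun l => hzle _))
    (by
      have h1 : 2 < A ^ (n + 1) * ε ^ d := by
        have hP : 0 < (16 * d * (d * A) ^ d : ℝ) ^ d := by positivity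
        rw [hε, div_pow, one_pow, mul_one_div, lt_div_iff₀ hP, pow_succ]
        have e1 : (16 * d * (d * A) ^ d : ℝ) ^ d = (16 * d) ^ d * d ^ (d ^ 2) * A ^ (d ^ 2) := by
          rw [mul_pow, ← pow_mul, ← pow_two, mul_pow (d:ℝ) A]; ring
        have e2 : A ^ n = A ^ (d ^ 2) * A ^ (d ^ 2) := by rw [hn, two_mul, pow_add]
        have e3 : ((16 * d) ^ d * d ^ (d ^ 2) : ℝ) ≤ A ^ (d ^ 2) := by
          calc ((16 * d) ^ d * d ^ (d ^ 2) : ℝ) ≤ (16 * d) ^ (d ^ 2) * d ^ (d ^ 2) := by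
                gcongr
                · linarith
                · nlinarith
            _ = (16 * d * d) ^ (d ^ 2) := by rw [← mul_pow]
            _ ≤ _ := by
                gcongr
                rw [hA]
                have : (d:ℝ) * d ≤ d ^ 3 := by
                  have : (d:ℝ) ^ 3 = d * d * d := by ring
                  rw [this]
                  exact le_mul_of_one_le_right (by positivity) hd1
                linarith
        rw [e1, e2]
        have hAp : 0 < A ^ (d ^ 2) := by positivity
        calc 2 * ((16 * d) ^ d * d ^ (d ^ 2) * A ^ (d ^ 2)) ≤ 2 * (A ^ (d ^ 2) * A ^ (d ^ 2)) := by
              gcongr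
          _ < A * (A ^ (d ^ 2) * A ^ (d ^ 2)) := by gcongr; linarith
          _ = _ := by ring
      calc 2 * De < (A ^ (n + 1) * ε ^ d) * De := by gcongr
        _ = _ := by ring)
  have hzi' : z i = x i := by simp [hz, hi]
  have hWex : ∀ l, ∃ W : Matrix (Fin d) (Fin d) ℂ, g l ≤ n →
      W ∈ T ^ (g l - i) ∧ x (g l) = W.mulVec (x i) := by
    intro l
    by_cases h : g l ≤ n
    · have h1 := (hg l).1
      obtain ⟨u, hu, e⟩ := path_word T n x hx i (g l - i) (by omega)
      have e2 : i + (g l - i) = g l := by omega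
      rw [e2] at e
      exact ⟨u, fun _ => ⟨hu, e⟩⟩
    · exact ⟨0, fun h' => absurd h' h⟩
  choose W hW using hWex
  set a' : Fin d → ℂ := fun l => if g l ≤ n then a l else 0 with ha'
  set len : Fin d → ℕ := fun l => if g l ≤ n then g l - i else 1 with hlen
  have hlen1 : ∀ l, 1 ≤ len l := by
    intro l
    have := (hg l).1
    simp only [hlen]; split_ifs <;> omega
  have hlenn : ∀ l, len l ≤ n := by
    intro l
    simp only [hlen]; split_ifs <;> omega
  have ha'A : ∀ l, ‖a' l‖ ≤ A := by
    intro l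
    simp only [ha']
    split_ifs
    · exact ha l
    · simpa using hA0.le
  have hW' : ∀ l, a' l ≠ 0 → W l ∈ T ^ (len l) := by
    intro l h0
    by_cases h : g l ≤ n
    · simp only [hlen, if_pos h]
      exact (hW l h).1
    · simp [ha', h] at h0
  set M := ∑ l, a' l • W l with hM
  have hMy : ∀ y, M.mulVec y = ∑ l, a' l • (W l).mulVec y := by
    intro y
    rw [hM, Matrix.sum_mulVec]
    simp [Matrix.smul_mulVec]
  set β := ∑ l, ‖a' l‖ * lam ^ (len l) with hβ
  have hlam1 : lam ≤ 1 := by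
    have : (1:ℝ) ≤ 2 ^ 8 * d ^ 5 := by
      have : (1:ℝ) ≤ d ^ 5 := one_le_pow₀ hd1
      linarith
    nlinarith
  have hβ0 : 0 ≤ β := by rw [hβ]; positivity
  have hβle : β ≤ d * (A * lam) := by
    rw [hβ]
    refine (Finset.sum_le_card_nsmul _ _ (A * lam) ?_).trans ?_
    · intro l _
      gcongr
      · exact ha'A l
      · exact pow_le_of_le_one hlam hlam1 (by have := hlen1 l; omega)
    · simp
  have hfin := perturb hd M v (x i) (d * A) β (d * (A * ε)) hβ0 hdA
    (by
      calc d * β ≤ d * (d * (A * lam)) := by gcongr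
        _ = (lam * (2 ^ 8 * d ^ 5)) / 4 := by rw [hA]; ring
        _ ≤ 1 / 4 := by gcongr)
    (by
      intro y
      rw [hMy]
      have h1 : v (∑ l, a' l • (W l).mulVec y) ≤ ∑ l, v (a' l • (W l).mulVec y) :=
        Finset.le_sum_of_subadditive v (map_zero v).le (map_add_le_add v) _ _
      refine h1.trans ((Finset.sum_le_card_nsmul _ _ (A * v y) ?_).trans ?_)
      · intro l _
        rw [map_smul_eq_mul]
        by_cases h0 : a' l = 0
        · rw [h0, norm_zero, zero_mul]
          exact mul_nonneg hA0.le (apply_nonneg v y)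
        · gcongr
          · exact ha'A l
          · exact word_contr T v hT _ _ (hW' l h0) y
      · simp [mul_assoc])
    (by
      have h0 : x i - M.mulVec (x i) = ∑ l, (a l • z (g l) - a' l • (W l).mulVec (x i)) := by
        rw [Finset.sum_sub_distrib, ← hMy, ← hzi, hzi']
      rw [h0]
      have h1 : v (∑ l, (a l • z (g l) - a' l • (W l).mulVec (x i))) ≤
          ∑ l, v (a l • z (g l) - a' l • (W l).mulVec (x i)) :=
        Finset.le_sum_of_subadditive v (map_zero v).le (map_add_le_add v) _ _
      refine h1.trans ((Finset.sum_le_card_nsmul _ _ (A * ε) ?_).trans ?_)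
      · intro l _
        by_cases h : g l ≤ n
        · have e1 : z (g l) = (W l).mulVec (x i) := by
            rw [← (hW l h).2]; simp [hz, h]
          rw [e1]
          simp only [ha', if_pos h, sub_self, map_zero]
          positivity
        · simp only [ha', if_neg h, zero_smul, sub_zero]
          rw [map_smul_eq_mul]
          gcongr
          · exact ha l
          · exact hzbig _ (not_le.1 h)
      · simp)
    (by
      intro k hk1 hkd
      have := trace_comb T lam (2 * d ^ 3) n htr a' W len hlenn hW' k 0 (by
        rw [hn]; nlinarith [Nat.mul_le_mul_right (2 * d ^ 2) hkd]) 1 (by simp)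
      simpa using this)
  have hval : 4 * d * (d * A) ^ (d - 1) * (d * (A * ε)) = 1 / 4 := by
    have h1 : (d * A) ^ (d - 1) * (d * A) = (d * A) ^ d := by
      rw [← pow_succ]; congr 1; omega
    have h2 : 4 * d * (d * A) ^ (d - 1) * (d * (A * ε)) = 4 * d * (d * A) ^ d * ε := by
      rw [← h1]; ring
    rw [h2, hε]
    field_simp
    norm_num
  have := hlo i hi
  linarith

theorem word_bound {d : ℕ} (S : Set (Matrix (Fin d) (Fin d) ℂ)) (C : ℝ) (hC0 : 0 ≤ C)
    (hC : ∀ A ∈ S, ∀ x, ‖A.mulVec x‖ ≤ C * ‖x‖) (n : ℕ) :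
    ∀ A ∈ S ^ n, ∀ x, ‖A.mulVec x‖ ≤ C ^ n * ‖x‖ := by
  induction n with
  | zero =>
    intro w hw x
    rw [pow_zero, Set.mem_one] at hw
    simp [hw]
  | succ n ih =>
    intro w hw x
    rw [pow_succ', Set.mem_mul] at hw
    obtain ⟨s, hs, w', hw', rfl⟩ := hw
    rw [← Matrix.mulVec_mulVec]
    calc _ ≤ C * ‖w'.mulVec x‖ := hC s hs _
      _ ≤ C * (C ^ n * ‖x‖) := by gcongr; exact ih w' hw' x
      _ = _ := by ring

theorem matBdd_bound {d : ℕ} (S : Set (Matrix (Fin d) (Fin d) ℂ)) (hS : MatBdd S) :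
    ∃ C : ℝ, 0 ≤ C ∧ ∀ A ∈ S, ∀ x, ‖A.mulVec x‖ ≤ C * ‖x‖ := by
  obtain ⟨C, hC⟩ := hS
  refine ⟨d * max C 0, by positivity, fun A hA x => ?_⟩
  rw [pi_norm_le_iff_of_nonneg (by positivity)]
  intro i
  simp only [Matrix.mulVec, dotProduct]
  refine (norm_sum_le _ _).trans ((Finset.sum_le_card_nsmul _ _ (max C 0 * ‖x‖) ?_).trans ?_)
  · intro j _
    rw [norm_mul]
    gcongr
    · exact (hC A hA i j).trans (le_max_left _ _)
    · exact norm_le_pi_norm x j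
  · simp [mul_assoc]

theorem opNorm_le_of {d : ℕ} (A : Matrix (Fin d) (Fin d) ℂ) (c : ℝ) (hc : 0 ≤ c)
    (h : ∀ x, ‖A.mulVec x‖ ≤ c * ‖x‖) : opNorm stdNorm A ≤ c := by
  apply Real.sSup_le _ hc
  rintro _ ⟨x, hx, rfl⟩
  exact (h x).trans (mul_le_of_le_one_right hc hx)

theorem le_opNorm_of {d : ℕ} (A : Matrix (Fin d) (Fin d) ℂ) (c : ℝ) (hc : 0 ≤ c)
    (h : ∀ x, ‖A.mulVec x‖ ≤ c * ‖x‖) (x : Fin d → ℂ) :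
    ‖A.mulVec x‖ ≤ opNorm stdNorm A * ‖x‖ := by
  have hb : BddAbove {c : ℝ | ∃ x : Fin d → ℂ, stdNorm x ≤ 1 ∧ c = stdNorm (A.mulVec x)} := by
    refine ⟨c, ?_⟩
    rintro _ ⟨x, hx, rfl⟩
    exact (h x).trans (mul_le_of_le_one_right hc hx)
  by_cases hx : x = 0
  · simp [hx]
  have hx0 : 0 < ‖x‖ := norm_pos_iff.2 hx
  have h1 : ‖A.mulVec (((‖x‖ : ℂ)⁻¹) • x)‖ ≤ opNorm stdNorm A := by
    refine le_csSup hb ⟨((‖x‖ : ℂ)⁻¹) • x, ?_, rfl⟩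
    simp only [stdNorm]
    rw [norm_smul, norm_inv, Complex.norm_real, norm_norm, inv_mul_cancel₀ hx0.ne']
  rw [Matrix.mulVec_smul, norm_smul, norm_inv, Complex.norm_real, norm_norm,
    inv_mul_le_iff₀ hx0] at h1
  linarith

theorem opNorm_nonneg' {d : ℕ} (A : Matrix (Fin d) (Fin d) ℂ) : 0 ≤ opNorm stdNorm A := by
  apply Real.sSup_nonneg
  rintro _ ⟨x, hx, rfl⟩
  exact norm_nonneg _

theorem setOpNorm_nonneg' {d : ℕ} (S : Set (Matrix (Fin d) (Fin d) ℂ)) :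
    0 ≤ setOpNorm stdNorm S := by
  apply Real.sSup_nonneg
  rintro _ ⟨x, hx, rfl⟩
  exact opNorm_nonneg' _

theorem jsr_bdd {d : ℕ} (S : Set (Matrix (Fin d) (Fin d) ℂ)) : BddBelow (Set.range
    fun n : ℕ => setOpNorm stdNorm (S ^ (n + 1)) ^ (1 / (n + 1 : ℝ))) := by
  refine ⟨0, ?_⟩
  rintro _ ⟨n, rfl⟩
  exact Real.rpow_nonneg (setOpNorm_nonneg' _) _

theorem jsr_nonneg {d : ℕ} (S : Set (Matrix (Fin d) (Fin d) ℂ)) : 0 ≤ jsr S :=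
  Real.iInf_nonneg fun _ => Real.rpow_nonneg (setOpNorm_nonneg' _) _

theorem rpow_root_pow (y : ℝ) (hy : 0 ≤ y) (n : ℕ) : (y ^ (1 / (n + 1 : ℝ))) ^ (n + 1) = y := by
  have := Real.rpow_inv_natCast_pow hy (Nat.succ_ne_zero n)
  rw [one_div]
  exact_mod_cast this

theorem jsr_pow_le {d : ℕ} (S : Set (Matrix (Fin d) (Fin d) ℂ)) (n : ℕ) (hn : 0 < n) :
    jsr S ^ n ≤ setOpNorm stdNorm (S ^ n) := by
  obtain ⟨m, rfl⟩ : ∃ m, n = m + 1 := ⟨n - 1, by omega⟩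
  have h1 : jsr S ≤ setOpNorm stdNorm (S ^ (m + 1)) ^ (1 / (m + 1 : ℝ)) :=
    ciInf_le (jsr_bdd S) m
  calc jsr S ^ (m + 1) ≤ (setOpNorm stdNorm (S ^ (m + 1)) ^ (1 / (m + 1 : ℝ))) ^ (m + 1) := by
        gcongr
        exact jsr_nonneg S
    _ = _ := rpow_root_pow _ (setOpNorm_nonneg' _) _

theorem jsr_pow_le_of {d : ℕ} (S : Set (Matrix (Fin d) (Fin d) ℂ)) (n : ℕ) (hn : 0 < n) (c : ℝ)
    (hc : 0 ≤ c) (h : ∀ A ∈ S ^ n, ∀ x, ‖A.mulVec x‖ ≤ c * ‖x‖) : jsr S ^ n ≤ c := by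
  refine (jsr_pow_le S n hn).trans ?_
  apply Real.sSup_le _ hc
  rintro _ ⟨A, hA, rfl⟩
  exact opNorm_le_of A c hc (h A hA)

theorem exists_of_jsr_lt {d : ℕ} (S : Set (Matrix (Fin d) (Fin d) ℂ)) (C : ℝ) (hC0 : 0 ≤ C)
    (hC : ∀ A ∈ S, ∀ x, ‖A.mulVec x‖ ≤ C * ‖x‖) (τ : ℝ) (hτ : jsr S < τ) :
    ∃ m : ℕ, 0 < m ∧ ∀ A ∈ S ^ m, ∀ x, ‖A.mulVec x‖ ≤ τ ^ m * ‖x‖ := by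
  obtain ⟨n, hn⟩ := exists_lt_of_ciInf_lt hτ
  refine ⟨n + 1, Nat.succ_pos n, fun A hA x => ?_⟩
  have hwb := word_bound S C hC0 hC (n + 1)
  have hb : BddAbove (opNorm stdNorm '' (S ^ (n + 1))) := by
    refine ⟨C ^ (n + 1), ?_⟩
    rintro _ ⟨A, hA, rfl⟩
    exact opNorm_le_of A _ (by positivity) (hwb A hA)
  have h1 := le_opNorm_of A _ (by positivity) (hwb A hA) x
  have h2 : opNorm stdNorm A ≤ setOpNorm stdNorm (S ^ (n + 1)) := le_csSup hb ⟨A, hA, rfl⟩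
  have h3 : setOpNorm stdNorm (S ^ (n + 1)) ≤ τ ^ (n + 1) := by
    rw [← rpow_root_pow _ (setOpNorm_nonneg' (S ^ (n + 1))) n]
    exact pow_le_pow_left₀ (Real.rpow_nonneg (setOpNorm_nonneg' _) _) hn.le _
  refine h1.trans ?_
  gcongr
  exact h2.trans h3

/-- power boundedness at any rate above the joint spectral radius -/
theorem power_bound {d : ℕ} (S : Set (Matrix (Fin d) (Fin d) ℂ)) (hS : MatBdd S) (τ : ℝ)
    (hτ : jsr S < τ) : ∃ D : ℝ, 1 ≤ D ∧ ∀ n, ∀ A ∈ S ^ n, ∀ x, ‖A.mulVec x‖ ≤ D * τ ^ n * ‖x‖ := by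
  obtain ⟨C, hC0, hC⟩ := matBdd_bound S hS
  obtain ⟨m, hm, hmb⟩ := exists_of_jsr_lt S C hC0 hC τ hτ
  have hτ0 : 0 < τ := lt_of_le_of_lt (jsr_nonneg S) hτ
  have hE : 1 ≤ max 1 (C / τ) := le_max_left _ _
  refine ⟨(max 1 (C / τ)) ^ m, one_le_pow₀ hE, fun n => ?_⟩
  induction n using Nat.strong_induction_on with
  | _ n ih =>
  intro A hA x
  rcases Nat.lt_or_ge n m with h | h
  · refine (word_bound S C hC0 hC n A hA x).trans ?_
    gcongr
    calc C ^ n = (C / τ) ^ n * τ ^ n := by rw [← mul_pow, div_mul_cancel₀ _ hτ0.ne']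
      _ ≤ (max 1 (C / τ)) ^ n * τ ^ n := by gcongr <;> exact le_max_right _ _
      _ ≤ (max 1 (C / τ)) ^ m * τ ^ n := by gcongr
  · obtain ⟨r, rfl⟩ := Nat.exists_eq_add_of_le h
    rw [pow_add, Set.mem_mul] at hA
    obtain ⟨B, hB, A', hA', rfl⟩ := hA
    rw [← Matrix.mulVec_mulVec]
    calc _ ≤ τ ^ m * ‖A'.mulVec x‖ := hmb B hB _
      _ ≤ τ ^ m * ((max 1 (C / τ)) ^ m * τ ^ r * ‖x‖) := by
          gcongr
          exact ih r (by omega) A' hA' x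
      _ = _ := by rw [pow_add]; ring

/-- the Rota and Strang norm of a power bounded set -/
theorem exists_norm {d : ℕ} (T : Set (Matrix (Fin d) (Fin d) ℂ)) (D : ℝ)
    (hD : ∀ n, ∀ A ∈ T ^ n, ∀ x, ‖A.mulVec x‖ ≤ D * ‖x‖) :
    ∃ v : Seminorm ℂ (Fin d → ℂ), (∀ x, ‖x‖ ≤ v x) ∧ (∀ x, v x ≤ D * ‖x‖) ∧
      ∀ A ∈ T, ∀ x, v (A.mulVec x) ≤ v x := by
  set X : (Fin d → ℂ) → Set ℝ := fun x => {r | ∃ n, ∃ A ∈ T ^ n, r = ‖A.mulVec x‖} with hX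
  have hb : ∀ x, BddAbove (X x) := by
    intro x
    refine ⟨D * ‖x‖, ?_⟩
    rintro _ ⟨n, A, hA, rfl⟩
    exact hD n A hA x
  have hmem : ∀ x, ‖x‖ ∈ X x := fun x => ⟨0, 1, by simp, by simp⟩
  have hne : ∀ x, (X x).Nonempty := fun x => ⟨_, hmem x⟩
  have hle : ∀ x, ‖x‖ ≤ sSup (X x) := fun x => le_csSup (hb x) (hmem x)
  refine ⟨Seminorm.ofSMulLE (fun x => sSup (X x)) ?_ ?_ ?_, ?_, ?_, ?_⟩
  · apply le_antisymm
    · apply csSup_le (hne 0)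
      rintro _ ⟨n, A, hA, rfl⟩
      simp
    · simpa using hle 0
  · intro x y
    apply csSup_le (hne _)
    rintro _ ⟨n, A, hA, rfl⟩
    rw [Matrix.mulVec_add]
    exact (norm_add_le _ _).trans
      (add_le_add (le_csSup (hb x) ⟨n, A, hA, rfl⟩) (le_csSup (hb y) ⟨n, A, hA, rfl⟩))
  · intro r x
    apply csSup_le (hne _)
    rintro _ ⟨n, A, hA, rfl⟩
    rw [Matrix.mulVec_smul, norm_smul]
    gcongr
    exact le_csSup (hb x) ⟨n, A, hA, rfl⟩
  · exact hle
  · intro x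
    apply csSup_le (hne _)
    rintro _ ⟨n, A, hA, rfl⟩
    exact hD n A hA x
  · intro A hA x
    apply csSup_le (hne _)
    rintro _ ⟨n, B, hB, rfl⟩
    refine le_csSup (hb x) ⟨n + 1, B * A, ?_, ?_⟩
    · rw [pow_succ]; exact Set.mul_mem_mul hB hA
    · rw [Matrix.mulVec_mulVec]

theorem norm_le_specRad {d : ℕ} (A : Matrix (Fin d) (Fin d) ℂ) (μ : ℂ) (hμ : μ ∈ spectrum ℂ A) :
    ‖μ‖ ≤ specRad A := by
  refine le_csSup ?_ ⟨μ, hμ, rfl⟩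
  have hfin : (spectrum ℂ A).Finite := by
    refine (A.charpoly.roots.toFinset.finite_toSet).subset ?_
    intro r hr
    rw [Matrix.mem_spectrum_iff_isRoot_charpoly] at hr
    simp [A.charpoly_monic.ne_zero]
    exact hr
  exact (hfin.image _).bddAbove

theorem specRad_le {d : ℕ} (A : Matrix (Fin d) (Fin d) ℂ) (c : ℝ) (hc : 0 ≤ c)
    (h : ∀ x, ‖A.mulVec x‖ ≤ c * ‖x‖) : specRad A ≤ c := by
  apply Real.sSup_le _ hc
  rintro _ ⟨μ, hμ, rfl⟩
  rw [Matrix.mem_spectrum_iff_isRoot_charpoly, Polynomial.IsRoot, Matrix.eval_charpoly,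
    ← Matrix.exists_mulVec_eq_zero_iff] at hμ
  obtain ⟨x, hx, he⟩ := hμ
  have e : A.mulVec x = μ • x := by
    rw [Matrix.sub_mulVec, sub_eq_zero] at he
    rw [← he]
    ext i
    simp [Matrix.mulVec_diagonal]
  have h1 := h x
  rw [e, norm_smul] at h1
  exact le_of_mul_le_mul_right h1 (norm_pos_iff.2 hx)

theorem specRad_nonneg {d : ℕ} (A : Matrix (Fin d) (Fin d) ℂ) : 0 ≤ specRad A := by
  apply Real.sSup_nonneg
  rintro _ ⟨x, hx, rfl⟩
  exact norm_nonneg _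

theorem lamSet_nonneg {d : ℕ} (S : Set (Matrix (Fin d) (Fin d) ℂ)) : 0 ≤ lamSet S := by
  apply Real.sSup_nonneg
  rintro _ ⟨x, hx, rfl⟩
  exact specRad_nonneg _

theorem trace_le {d : ℕ} (A : Matrix (Fin d) (Fin d) ℂ) : ‖A.trace‖ ≤ d * specRad A := by
  obtain ⟨ν, h1, h2⟩ := exists_eig A
  have h3 := h2 1
  simp only [pow_one] at h3
  rw [h3]
  refine (norm_sum_le _ _).trans ((Finset.sum_le_card_nsmul _ _ (specRad A) ?_).trans ?_)
  · intro i _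
    apply norm_le_specRad
    apply Matrix.mem_spectrum_of_isRoot_charpoly
    have : ν i ∈ A.charpoly.roots := by
      rw [h1]
      exact Multiset.mem_map_of_mem _ (Finset.mem_univ i)
    exact (Polynomial.mem_roots'.1 this).2
  · simp

theorem mem_smul_pow {d : ℕ} (S : Set (Matrix (Fin d) (Fin d) ℂ)) (t : ℂ) (n : ℕ) :
    (∀ N ∈ ((fun A => t • A) '' S) ^ n, ∃ A ∈ S ^ n, N = t ^ n • A) ∧
    (∀ A ∈ S ^ n, t ^ n • A ∈ ((fun A => t • A) '' S) ^ n) := by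
  induction n with
  | zero => simp
  | succ n ih =>
    constructor
    · intro N hN
      rw [pow_succ', Set.mem_mul] at hN
      obtain ⟨_, ⟨s, hs, rfl⟩, w, hw, rfl⟩ := hN
      obtain ⟨A, hA, rfl⟩ := ih.1 w hw
      refine ⟨s * A, ?_, ?_⟩
      · rw [pow_succ']; exact Set.mul_mem_mul hs hA
      · simp [smul_smul, pow_succ]
    · intro N hN
      rw [pow_succ', Set.mem_mul] at hN
      obtain ⟨s, hs, A, hA, rfl⟩ := hN
      have : t ^ (n + 1) • (s * A) = (t • s) * (t ^ n • A) := by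
        simp [smul_smul, pow_succ]
      rw [this, pow_succ' (_ '' _)]
      exact Set.mul_mem_mul ⟨s, hs, rfl⟩ (ih.2 A hA)

theorem bochi_first {d : ℕ} (hd : 0 < d) (S : Set (Matrix (Fin d) (Fin d) ℂ)) (hS : MatBdd S) :
    ∃ k : ℕ, 1 ≤ k ∧ k ≤ 2 * d ^ 3 ∧
      jsr S / (2 ^ 8 * d ^ 5) ≤ lamSet (S ^ k) ^ ((k : ℝ)⁻¹) := by
  by_contra hcon
  push Not at hcon
  have hd0 : (0:ℝ) < d := by exact_mod_cast hd
  set ρ := jsr S with hρ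
  have hQ : (0:ℝ) < 2 ^ 8 * d ^ 5 := by positivity
  have hρ0 : 0 < ρ := by
    have h1 := hcon 1 le_rfl (by have := Nat.pow_pos (n := 3) hd; omega)
    have h2 : 0 ≤ lamSet (S ^ 1) ^ (((1:ℕ) : ℝ)⁻¹) := Real.rpow_nonneg (lamSet_nonneg _) _
    have h3 := lt_of_le_of_lt h2 h1
    by_contra h
    exact absurd h3 (not_lt.2 (div_nonpos_of_nonpos_of_nonneg (not_lt.1 h) hQ.le))
  obtain ⟨C, hC0, hC⟩ := matBdd_bound S hS
  set n := 2 * d ^ 2 with hn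
  have hn0 : 0 < n := by rw [hn]; positivity
  have hnR : (1:ℝ) ≤ n := by exact_mod_cast hn0
  -- the scale `τ`
  set θ : ℝ := 1 - 1 / (4 * n) with hθ
  have hq : 0 < 1 / (4 * (n:ℝ)) := by positivity
  have hq2 : 1 / (4 * (n:ℝ)) ≤ 1 / 4 := by
    apply one_div_le_one_div_of_le <;> linarith
  have hθ0 : 0 < θ := by rw [hθ]; linarith
  have hθ1 : θ < 1 := by rw [hθ]; linarith
  have hθn : 3 / 4 ≤ θ ^ n := by
    have h1 := one_add_mul_le_pow (a := -(1 / (4 * (n:ℝ)))) (by linarith) n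
    have h2 : (1:ℝ) + n * (-(1 / (4 * (n:ℝ)))) = 3 / 4 := by
      field_simp; norm_num
    rw [h2] at h1
    rw [hθ, sub_eq_add_neg]
    exact h1
  set τ := ρ / θ with hτ
  have hτ0 : 0 < τ := by positivity
  have hρτ : ρ < τ := by
    rw [hτ, lt_div_iff₀ hθ0]
    nlinarith
  have hρn : 3 / 4 * τ ^ n ≤ ρ ^ n := by
    have : ρ = θ * τ := by rw [hτ]; field_simp
    rw [this, mul_pow]
    gcongr
  obtain ⟨D, hD1, hD⟩ := power_bound S hS τ hρτ
  set t : ℂ := ((τ⁻¹ : ℝ) : ℂ) with ht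
  have htn : ∀ k : ℕ, ‖t ^ k‖ = (τ ^ k)⁻¹ := by
    intro k
    rw [norm_pow, ht, Complex.norm_real, Real.norm_of_nonneg (inv_nonneg.2 hτ0.le), inv_pow]
  set T := (fun A => t • A) '' S with hT
  have hTD : ∀ k, ∀ A ∈ T ^ k, ∀ x, ‖A.mulVec x‖ ≤ D * ‖x‖ := by
    intro k N hN x
    obtain ⟨A, hA, rfl⟩ := (mem_smul_pow S t k).1 N hN
    rw [Matrix.smul_mulVec, norm_smul, htn, inv_mul_le_iff₀ (by positivity)]
    refine (hD k A hA x).trans (le_of_eq (by ring))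
  obtain ⟨v, hv1, hv2, hvT⟩ := exists_norm T D hTD
  -- a long nearly norming word
  have hword : ∃ w ∈ T ^ n, ∃ x0, v x0 ≤ 1 ∧ 1 / 2 ≤ v (w.mulVec x0) := by
    by_contra hno
    push Not at hno
    have hhalf : ∀ w ∈ T ^ n, ∀ x, v (w.mulVec x) ≤ 1 / 2 * v x := by
      intro w hw x
      by_cases hx : x = 0
      · simp [hx]
      have hvx : 0 < v x := lt_of_lt_of_le (norm_pos_iff.2 hx) (hv1 x)
      have h1 := hno w hw (((v x : ℂ)⁻¹) • x) (by
        rw [map_smul_eq_mul, norm_inv, Complex.norm_real, Real.norm_of_nonneg hvx.le,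
          inv_mul_cancel₀ hvx.ne'])
      rw [Matrix.mulVec_smul, map_smul_eq_mul, norm_inv, Complex.norm_real,
        Real.norm_of_nonneg hvx.le, inv_mul_lt_iff₀ hvx] at h1
      linarith
    have hiter : ∀ m : ℕ, ∀ w ∈ T ^ (n * m), ∀ x, v (w.mulVec x) ≤ (1 / 2) ^ m * v x := by
      intro m
      induction m with
      | zero =>
        intro w hw x
        rw [mul_zero, pow_zero, Set.mem_one] at hw
        simp [hw]
      | succ m ih =>
        intro w hw x
        rw [Nat.mul_succ, pow_add, Set.mem_mul] at hw
        obtain ⟨w1, hw1, w2, hw2, rfl⟩ := hw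
        rw [← Matrix.mulVec_mulVec]
        calc _ ≤ (1 / 2) ^ m * v (w2.mulVec x) := ih w1 hw1 _
          _ ≤ (1 / 2) ^ m * (1 / 2 * v x) := by gcongr; exact hhalf w2 hw2 x
          _ = _ := by ring
    have hbound : ∀ m : ℕ, 0 < m → (3 / 2 : ℝ) ^ m ≤ D := by
      intro m hm
      have h1 : ρ ^ (n * m) ≤ (1 / 2) ^ m * D * τ ^ (n * m) := by
        refine jsr_pow_le_of S (n * m) (by positivity) _ (by positivity) ?_
        intro A hA x
        have h2 := (mem_smul_pow S t (n * m)).2 A hA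
        have h3 := (hv1 _).trans ((hiter m _ h2 x).trans
          (mul_le_mul_of_nonneg_left (hv2 x) (by positivity)))
        rw [Matrix.smul_mulVec, norm_smul, htn, inv_mul_le_iff₀ (by positivity)] at h3
        refine h3.trans (le_of_eq (by ring))
      have h4 : (3 / 4 : ℝ) ^ m * τ ^ (n * m) ≤ ρ ^ (n * m) := by
        rw [pow_mul τ n m, pow_mul ρ n m, ← mul_pow]
        exact pow_le_pow_left₀ (by positivity) hρn m
      have h5 := le_of_mul_le_mul_right (h4.trans h1) (by positivity)
      have h6 : (3 / 4 : ℝ) ^ m = (1 / 2) ^ m * (3 / 2) ^ m := by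
        rw [← mul_pow]; norm_num
      rw [h6] at h5
      exact le_of_mul_le_mul_left h5 (by positivity)
    obtain ⟨m, hm⟩ := pow_unbounded_of_one_lt D (by norm_num : (1:ℝ) < 3 / 2)
    have h7 := hbound (m + 1) (Nat.succ_pos m)
    have h8 : (3 / 2 : ℝ) ^ m ≤ (3 / 2) ^ (m + 1) := pow_le_pow_right₀ (by norm_num) (by omega)
    linarith
  obtain ⟨w, hw, x0, hx0, hwx⟩ := hword
  refine core hd T (ρ / (2 ^ 8 * d ^ 5) / τ) (by positivity) ?_ v hv1 hvT ?_ w hw x0 hx0 hwx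
  · have : ρ / (2 ^ 8 * d ^ 5) / τ * (2 ^ 8 * d ^ 5) = ρ / τ := by field_simp
    rw [this, div_le_one hτ0]
    exact hρτ.le
  · intro l hl N hN
    rcases Nat.eq_zero_or_pos l with rfl | hl0
    · rw [pow_zero, Set.mem_one] at hN
      simp [hN]
    obtain ⟨A, hA, rfl⟩ := (mem_smul_pow S t l).1 N hN
    have hwb := word_bound S C hC0 hC l
    have hb : BddAbove (specRad '' (S ^ l)) := by
      refine ⟨C ^ l, ?_⟩
      rintro _ ⟨A, hA, rfl⟩
      exact specRad_le A _ (by positivity) (hwb A hA)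
    have h1 : specRad A ≤ lamSet (S ^ l) := le_csSup hb ⟨A, hA, rfl⟩
    have h2 : lamSet (S ^ l) ≤ (ρ / (2 ^ 8 * d ^ 5)) ^ l := by
      rw [← Real.rpow_inv_natCast_pow (lamSet_nonneg (S ^ l)) hl0.ne']
      exact pow_le_pow_left₀ (Real.rpow_nonneg (lamSet_nonneg _) _) (hcon l hl0 hl).le _
    rw [Matrix.trace_smul, norm_smul, htn, div_pow _ τ, inv_mul_le_iff₀ (by positivity)]
    calc ‖A.trace‖ ≤ d * specRad A := trace_le A
      _ ≤ d * (ρ / (2 ^ 8 * d ^ 5)) ^ l := by gcongr; exact h1.trans h2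
      _ = _ := by field_simp

theorem jsr_pow_ge {d : ℕ} (S : Set (Matrix (Fin d) (Fin d) ℂ)) (m : ℕ) (hm : 0 < m) :
    jsr S ^ m ≤ jsr (S ^ m) := by
  apply le_ciInf
  intro n
  have h1 := jsr_pow_le S (m * (n + 1)) (by positivity)
  rw [pow_mul, pow_mul] at h1
  have h2 := Real.rpow_le_rpow (pow_nonneg (pow_nonneg (jsr_nonneg S) m) _) h1
    (by positivity : (0:ℝ) ≤ 1 / (n + 1 : ℝ))
  refine le_trans (le_of_eq ?_) h2
  have := Real.pow_rpow_inv_natCast (pow_nonneg (jsr_nonneg S) m) (Nat.succ_ne_zero n)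
  rw [one_div]
  exact_mod_cast this.symm

theorem matBdd_pow {d : ℕ} (S : Set (Matrix (Fin d) (Fin d) ℂ)) (hS : MatBdd S) (m : ℕ) :
    MatBdd (S ^ m) := by
  obtain ⟨C, hC0, hC⟩ := matBdd_bound S hS
  refine ⟨C ^ m, fun A hA i j => ?_⟩
  have h1 := word_bound S C hC0 hC m A hA (Pi.single j 1)
  have h2 := (norm_le_pi_norm _ i).trans h1
  simpa [Pi.norm_single] using h2

/-- explicit polynomial Bochi inequality:
`max_{1 ≤ k ≤ 2d³} Λ(S^k)^{1/k} ≥ ρ(S)/(2⁸d⁵)`, and consequently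
`max_{1 ≤ k ≤ N₂(d)} Λ(S^k)^{1/k} ≥ ρ(S)/2` with `N₂(d) = 2d³⌈8 + 5log₂ d⌉`. -/
theorem stmt_16 {d : ℕ} (hd : 0 < d) (S : Set (Matrix (Fin d) (Fin d) ℂ)) (hS : MatBdd S) :
    (∃ k : ℕ, 1 ≤ k ∧ k ≤ 2 * d ^ 3 ∧
      jsr S / (2 ^ 8 * d ^ 5) ≤ lamSet (S ^ k) ^ ((k : ℝ)⁻¹)) ∧
    (∃ k : ℕ, 1 ≤ k ∧ k ≤ 2 * d ^ 3 * (⌈(8 + 5 * Real.logb 2 d : ℝ)⌉).toNat ∧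
      jsr S / 2 ≤ lamSet (S ^ k) ^ ((k : ℝ)⁻¹)) := by
  refine ⟨bochi_first hd S hS, ?_⟩
  have hd0 : (0:ℝ) < d := by exact_mod_cast hd
  have hd1 : (1:ℝ) ≤ d := by exact_mod_cast hd
  have hlog : 0 ≤ Real.logb 2 d := Real.logb_nonneg (by norm_num) hd1
  set m := (⌈(8 + 5 * Real.logb 2 d : ℝ)⌉).toNat with hm
  have hmle : (8 + 5 * Real.logb 2 d : ℝ) ≤ m := by
    have h1 := Int.le_ceil (8 + 5 * Real.logb 2 d : ℝ)
    have h2 := Int.self_le_toNat ⌈(8 + 5 * Real.logb 2 d : ℝ)⌉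
    refine h1.trans ?_
    exact_mod_cast h2
  have hm0 : 0 < m := by
    have : (0:ℝ) < m := by linarith
    exact_mod_cast this
  have hQm : (2 ^ 8 * d ^ 5 : ℝ) ≤ 2 ^ m := by
    have h1 : (2 ^ 8 * d ^ 5 : ℝ) = (2:ℝ) ^ (8 + 5 * Real.logb 2 d : ℝ) := by
      rw [Real.rpow_add (by norm_num), mul_comm (5:ℝ), Real.rpow_mul (by norm_num),
        Real.rpow_logb (by norm_num) (by norm_num) hd0]
      norm_cast
    rw [h1, ← Real.rpow_natCast]
    exact Real.rpow_le_rpow_of_exponent_le (by norm_num) hmle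
  obtain ⟨k, hk1, hk2, hk⟩ := bochi_first hd (S ^ m) (matBdd_pow S hS m)
  refine ⟨m * k, Nat.mul_pos hm0 hk1, ?_, ?_⟩
  · rw [mul_comm]; gcongr
  · rw [pow_mul]
    have hl := lamSet_nonneg ((S ^ m) ^ k)
    have hj := jsr_nonneg S
    have hj2 := jsr_nonneg (S ^ m)
    have h1 : (jsr S / 2) ^ m ≤ lamSet ((S ^ m) ^ k) ^ ((k : ℝ)⁻¹) := by
      refine le_trans ?_ hk
      rw [div_pow]
      have h2 := jsr_pow_ge S m hm0
      gcongr
    have h2 := Real.rpow_le_rpow (by positivity) h1 (by positivity : (0:ℝ) ≤ (m:ℝ)⁻¹)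
    rw [Real.pow_rpow_inv_natCast (by positivity) hm0.ne', ← Real.rpow_mul hl] at h2
    refine h2.trans (le_of_eq ?_)
    congr 1
    push_cast
    rw [mul_inv, mul_comm]
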